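/- arXiv:2601.12322 — 6 statements merged into one kernel-verified Lean document; each statement's English description precedes it below -/
import Mathlib

section
/- For every t ≥ 0, the OrLoMo global momentum u_{t+1} and the auxiliary momentum û_{t+1} satisfy û_{t+1} − u_{t+1} = Σ_{k ∈ [K], k ≠ k_t} β^{⌈t/K⌉ − ⌈ite(t,k)/K⌉} η̂_{ite(t,k),k} Δu_{ite(t,k)}^k. -/
open scoped BigOperators

/-- difference between the OrLoMo global momentum `u_{t+1}`
and the auxiliary momentum `û_{t+1}`:
`û_{t+1} − u_{t+1} = Σ_{k ≠ k_t} β^{⌈t/K⌉ − ⌈ite(t,k)/K⌉} η̂_{ite(t,k),k} Δu_{ite(t,k)}^k`.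
Here `⌈t/K⌉ = (t + K − 1)/K` (natural division) and `η̂_{t,k} = η_{next(t,k)}`. -/
theorem stmt_2 (d K : ℕ) (hK : 1 ≤ K) (β : ℝ) (hβ0 : 0 ≤ β) (hβ1 : β < 1)
    (kseq : ℕ → Fin K)
    (iteF : ℕ → Fin K → ℕ)
    (hite0 : ∀ k, iteF 0 k = 0)
    (hiteS : ∀ t k, iteF (t + 1) k = if k = kseq t then t + 1 else iteF t k)
    (nextF : ℕ → Fin K → ℕ)
    (hnext : ∀ t k, t ≤ nextF t k ∧ kseq (nextF t k) = k ∧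
      ∀ j, t ≤ j → kseq j = k → nextF t k ≤ j)
    (η : ℕ → ℝ) (hη : ∀ t, 0 < η t)
    (Δu : ℕ → Fin K → EuclideanSpace ℝ (Fin d))
    (u uhat : ℕ → EuclideanSpace ℝ (Fin d))
    (hu0 : u 0 = 0)
    (hu : ∀ t, u (t + 1) =
      (if 1 ≤ t ∧ K ∣ (t - 1) then β • u t else u t) +
      (β ^ ((t + K - 1) / K - (iteF t (kseq t) + K - 1) / K) *
        η (nextF (iteF t (kseq t)) (kseq t))) • Δu (iteF t (kseq t)) (kseq t))
    (huhat1 : uhat 1 = ∑ k, η (nextF 0 k) • Δu 0 k)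
    (huhatS : ∀ t, 1 ≤ t → uhat (t + 1) =
      (if K ∣ (t - 1) then β • uhat t else uhat t) +
      η (nextF t (kseq (t - 1))) • Δu t (kseq (t - 1))) :
    ∀ t, uhat (t + 1) - u (t + 1) =
      ∑ k ∈ Finset.univ.filter (fun k => k ≠ kseq t),
        (β ^ ((t + K - 1) / K - (iteF t k + K - 1) / K) *
          η (nextF (iteF t k) k)) • Δu (iteF t k) k := by
  have hle : ∀ t k, iteF t k ≤ t := by
    intro t
    induction t with
    | zero => intro k; rw [hite0]
    | succ n ih =>
      intro k
      rw [hiteS]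
      split_ifs
      · exact le_rfl
      · exact (ih k).trans (Nat.le_succ n)
  have hceil : ∀ t, (t + 1 + K - 1) / K = (t + K - 1) / K + if K ∣ t then 1 else 0 := by
    intro t
    have h1 : t + 1 + K - 1 = (t + K - 1) + 1 := by omega
    have h2 : (t + K - 1) + 1 = t + K := by omega
    rw [h1, Nat.succ_div, h2]
    simp
  obtain ⟨g, hg⟩ : ∃ g : ℕ → Fin K → EuclideanSpace ℝ (Fin d), ∀ t k, g t k =
      (β ^ ((t + K - 1) / K - (iteF t k + K - 1) / K) *
          η (nextF (iteF t k) k)) • Δu (iteF t k) k := ⟨_, fun _ _ => rfl⟩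
  have hgstep : ∀ t k, k ≠ kseq t → g (t + 1) k = if K ∣ t then β • g t k else g t k := by
    intro t k hk
    have hm : (iteF t k + K - 1) / K ≤ (t + K - 1) / K :=
      Nat.div_le_div_right (by have := hle t k; omega)
    rw [hg, hg, hiteS, if_neg hk, hceil]
    split_ifs
    · rw [Nat.sub_add_comm hm, pow_succ, smul_smul]
      congr 1
      ring
    · simp
  have hgself : ∀ t, g (t + 1) (kseq t) = η (nextF (t + 1) (kseq t)) • Δu (t + 1) (kseq t) := by
    intro t
    rw [hg, hiteS, if_pos rfl]
    simp
  simp only [← hg] at hu ⊢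
  intro t
  induction t with
  | zero =>
    have h0 : ∀ k, g 0 k = η (nextF 0 k) • Δu 0 k := by
      intro k
      rw [hg, hite0]
      simp
    rw [zero_add, huhat1, Finset.filter_ne', ← Finset.sum_erase_add _ _ (Finset.mem_univ (kseq 0))]
    have := hu 0
    simp only [hu0, zero_add] at this
    rw [this]
    simp [h0]
  | succ t ih =>
    have hall : ∑ k, g (t + 1) k = (if K ∣ t then β • (uhat (t + 1) - u (t + 1))
        else (uhat (t + 1) - u (t + 1))) + g (t + 1) (kseq t) := by
      rw [← Finset.sum_erase_add _ _ (Finset.mem_univ (kseq t)), ih, Finset.filter_ne',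
        Finset.sum_congr rfl (fun k hk => hgstep t k (Finset.ne_of_mem_erase hk))]
      split_ifs
      · rw [Finset.smul_sum]
      · rfl
    rw [Finset.filter_ne', Finset.sum_erase_eq_sub (Finset.mem_univ _), hall, hgself,
      huhatS (t + 1) (by omega), hu (t + 1)]
    simp only [Nat.add_sub_cancel, Nat.le_add_left, true_and]
    split_ifs
    · rw [smul_sub]; abel
    · abel
end

section
/- For every t ≥ 0, the OrLoMo global parameter w_{t+1} and the auxiliary parameter ŵ_{t+1} satisfy ŵ_{t+1} − w_{t+1} = −Σ_{k ∈ [K], k ≠ k_t} [ η̂_{ite(t,k),k} Δw_{ite(t,k)}^k + (β(1 − β^{⌈t/K⌉ − ⌈ite(t,k)/K⌉})/(1 − β)) η̂_{ite(t,k),k} Δu_{ite(t,k)}^k ]. -/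
open scoped BigOperators

/-- difference between the OrLoMo global parameter `w_{t+1}` and the
auxiliary parameter `ŵ_{t+1}`:
`ŵ_{t+1} − w_{t+1} = −Σ_{k ≠ k_t} [ η̂_{ite(t,k),k} Δw_{ite(t,k)}^k
  + (β(1 − β^{⌈t/K⌉ − ⌈ite(t,k)/K⌉})/(1 − β)) η̂_{ite(t,k),k} Δu_{ite(t,k)}^k ]`. -/
theorem stmt_3 (d K : ℕ) (hK : 1 ≤ K) (β : ℝ) (hβ0 : 0 ≤ β) (hβ1 : β < 1)
    (kseq : ℕ → Fin K)
    (iteF : ℕ → Fin K → ℕ)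
    (hite0 : ∀ k, iteF 0 k = 0)
    (hiteS : ∀ t k, iteF (t + 1) k = if k = kseq t then t + 1 else iteF t k)
    (nextF : ℕ → Fin K → ℕ)
    (hnext : ∀ t k, t ≤ nextF t k ∧ kseq (nextF t k) = k ∧
      ∀ j, t ≤ j → kseq j = k → nextF t k ≤ j)
    (η : ℕ → ℝ) (hη : ∀ t, 0 < η t)
    (Δu Δw : ℕ → Fin K → EuclideanSpace ℝ (Fin d))
    (w0 : EuclideanSpace ℝ (Fin d))
    (u w uhat what : ℕ → EuclideanSpace ℝ (Fin d))
    (hu0 : u 0 = 0) (hw0 : w 0 = w0)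
    (hu : ∀ t, u (t + 1) =
      (if 1 ≤ t ∧ K ∣ (t - 1) then β • u t else u t) +
      (β ^ ((t + K - 1) / K - (iteF t (kseq t) + K - 1) / K) *
        η (nextF (iteF t (kseq t)) (kseq t))) • Δu (iteF t (kseq t)) (kseq t))
    (hw : ∀ t, w (t + 1) =
      (if 1 ≤ t ∧ K ∣ (t - 1) then w t - β • u t else w t) -
      η (nextF (iteF t (kseq t)) (kseq t)) • Δw (iteF t (kseq t)) (kseq t) -
      (β * (1 - β ^ ((t + K - 1) / K - (iteF t (kseq t) + K - 1) / K)) / (1 - β) *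
        η (nextF (iteF t (kseq t)) (kseq t))) • Δu (iteF t (kseq t)) (kseq t))
    (huhat1 : uhat 1 = ∑ k, η (nextF 0 k) • Δu 0 k)
    (huhatS : ∀ t, 1 ≤ t → uhat (t + 1) =
      (if K ∣ (t - 1) then β • uhat t else uhat t) +
      η (nextF t (kseq (t - 1))) • Δu t (kseq (t - 1)))
    (hwhat1 : what 1 = w0 - ∑ k, η (nextF 0 k) • Δw 0 k)
    (hwhatS : ∀ t, 1 ≤ t → what (t + 1) =
      (if K ∣ (t - 1) then what t - β • uhat t else what t) -
      η (nextF t (kseq (t - 1))) • Δw t (kseq (t - 1))) :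
    ∀ t, what (t + 1) - w (t + 1) =
      -∑ k ∈ Finset.univ.filter (fun k => k ≠ kseq t),
        (η (nextF (iteF t k) k) • Δw (iteF t k) k +
          (β * (1 - β ^ ((t + K - 1) / K - (iteF t k + K - 1) / K)) / (1 - β) *
            η (nextF (iteF t k) k)) • Δu (iteF t k) k) := by
  have hle : ∀ t k, iteF t k ≤ t := by
    intro t k
    induction t with
    | zero => simp [hite0]
    | succ t ih => rw [hiteS]; split_ifs <;> omega
  obtain ⟨C, hC⟩ : ∃ C : ℕ → ℕ, ∀ t, C t = (t + K - 1) / K := ⟨_, fun _ => rfl⟩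
  have hCS : ∀ t, C (t + 1) = C t + if K ∣ t then 1 else 0 := by
    intro t
    rw [hC, hC]
    have h1 : t + 1 + K - 1 = (t + K - 1) + 1 := by omega
    have h2 : (t + K - 1) + 1 = t + K := by omega
    rw [h1, Nat.succ_div, h2]
    simp
  have hCm : ∀ t k, C (iteF t k) ≤ C t := by
    intro t k
    rw [hC, hC]
    have := hle t k
    exact Nat.div_le_div_right (by omega)
  have hC0 : C 0 = 0 := by
    rw [hC]; exact Nat.div_eq_of_lt (by omega)
  simp only [← hC] at hu hw ⊢
  obtain ⟨A, hA⟩ : ∃ A : ℕ → Fin K → EuclideanSpace ℝ (Fin d), ∀ t k, A t k =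
      (β ^ (C t - C (iteF t k)) * η (nextF (iteF t k) k)) • Δu (iteF t k) k :=
    ⟨_, fun _ _ => rfl⟩
  obtain ⟨B, hB⟩ : ∃ B : ℕ → Fin K → EuclideanSpace ℝ (Fin d), ∀ t k, B t k =
      η (nextF (iteF t k) k) • Δw (iteF t k) k +
          (β * (1 - β ^ (C t - C (iteF t k))) / (1 - β) *
            η (nextF (iteF t k) k)) • Δu (iteF t k) k :=
    ⟨_, fun _ _ => rfl⟩
  simp only [sub_sub] at hw
  simp only [← hA, ← hB] at hu hw ⊢
  have hAself : ∀ t, A (t + 1) (kseq t) = η (nextF (t + 1) (kseq t)) • Δu (t + 1) (kseq t) := by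
    intro t; simp [hA, hiteS]
  have hBself : ∀ t, B (t + 1) (kseq t) = η (nextF (t + 1) (kseq t)) • Δw (t + 1) (kseq t) := by
    intro t; simp [hB, hiteS]
  have hAS : ∀ t k, k ≠ kseq t → A (t + 1) k = if K ∣ t then β • A t k else A t k := by
    intro t k hk
    have h := hCm t k
    rw [hA, hA, hiteS, if_neg hk, hCS]
    split_ifs
    · rw [show C t + 1 - C (iteF t k) = (C t - C (iteF t k)) + 1 by omega, smul_smul]
      congr 1; ring
    · simp
  have hBS : ∀ t k, k ≠ kseq t → B (t + 1) k = if K ∣ t then B t k + β • A t k else B t k := by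
    intro t k hk
    have h := hCm t k
    have hb : (1 - β) ≠ 0 := by linarith
    rw [hA, hB, hB, hiteS, if_neg hk, hCS]
    split_ifs
    · rw [show C t + 1 - C (iteF t k) = (C t - C (iteF t k)) + 1 by omega, smul_smul, add_assoc,
        ← add_smul]
      congr 2; field_simp; ring
    · simp
  have split : ∀ (f : Fin K → EuclideanSpace ℝ (Fin d)) (a : Fin K),
      ∑ k, f k = f a + ∑ k ∈ Finset.univ.filter (fun k => k ≠ a), f k := by
    intro f a
    rw [Finset.filter_ne', Finset.add_sum_erase _ _ (Finset.mem_univ a)]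
  have hU : ∀ t, uhat (t + 1) = u (t + 1) +
      ∑ k ∈ Finset.univ.filter (fun k => k ≠ kseq t), A t k := by
    intro t
    induction t with
    | zero =>
      have h0 : ∑ k, η (nextF 0 k) • Δu 0 k = ∑ k, A 0 k := by
        simp [hA, hite0, hC0]
      rw [zero_add, huhat1, h0, split _ (kseq 0)]
      have := hu 0
      simp only [zero_add] at this
      rw [this]
      simp [hu0]
    | succ t ih =>
      have e := (split (A (t + 1)) (kseq t)).symm.trans (split (A (t + 1)) (kseq (t + 1)))
      rw [Finset.sum_congr rfl (fun k hk => hAS t k (by simpa using hk)), hAself] at e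
      rw [huhatS (t + 1) (by omega), hu (t + 1)]
      simp only [Nat.add_sub_cancel, Nat.le_add_left, true_and]
      rw [add_assoc, ← e, ih]
      split_ifs
      · rw [smul_add, Finset.smul_sum]; abel
      · abel
  intro t
  rw [sub_eq_iff_eq_add]
  induction t with
  | zero =>
    have h0 : ∑ k, η (nextF 0 k) • Δw 0 k = ∑ k, B 0 k := by
      simp [hB, hite0, hC0]
    rw [zero_add, hwhat1, h0, split _ (kseq 0)]
    have := hw 0
    simp only [zero_add] at this
    rw [this]
    simp [hw0]
    abel
  | succ t ih =>
    have e := (split (B (t + 1)) (kseq t)).symm.trans (split (B (t + 1)) (kseq (t + 1)))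
    rw [Finset.sum_congr rfl (fun k hk => hBS t k (by simpa using hk)), hBself,
      ← sub_eq_iff_eq_add'] at e
    rw [hwhatS (t + 1) (by omega), hw (t + 1), ← e]
    simp only [Nat.add_sub_cancel, Nat.le_add_left, true_and]
    rw [ih, hU]
    split_ifs
    · rw [smul_add, Finset.smul_sum, Finset.sum_add_distrib]; abel
    · abel
end

section
/- Assume that (1/(1−β)) Δh_0^k = (β/(1−β)) Δu_0^k + Δw_0^k for every k ∈ [K], and (1/(1−β)) Δh_t^{k_{t−1}} = (β/(1−β)) Δu_t^{k_{t−1}} + Δw_t^{k_{t−1}} for every t ≥ 1. Then for every t ≥ 1, ŷ_t − ŵ_t = −(β/(1−β)) û_t. -/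
open scoped BigOperators

/-- if `(1/(1−β)) Δh_0^k = (β/(1−β)) Δu_0^k + Δw_0^k` for every `k` and
`(1/(1−β)) Δh_t^{k_{t−1}} = (β/(1−β)) Δu_t^{k_{t−1}} + Δw_t^{k_{t−1}}` for every `t ≥ 1`,
then for every `t ≥ 1`, `ŷ_t − ŵ_t = −(β/(1−β)) û_t`. -/
theorem stmt_4 (d K : ℕ) (hK : 1 ≤ K) (β : ℝ) (hβ0 : 0 ≤ β) (hβ1 : β < 1)
    (kseq : ℕ → Fin K)
    (nextF : ℕ → Fin K → ℕ)
    (hnext : ∀ t k, t ≤ nextF t k ∧ kseq (nextF t k) = k ∧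
      ∀ j, t ≤ j → kseq j = k → nextF t k ≤ j)
    (η : ℕ → ℝ) (hη : ∀ t, 0 < η t)
    (Δu Δw Δh : ℕ → Fin K → EuclideanSpace ℝ (Fin d))
    (w0 : EuclideanSpace ℝ (Fin d))
    (uhat what yhat : ℕ → EuclideanSpace ℝ (Fin d))
    (huhat1 : uhat 1 = ∑ k, η (nextF 0 k) • Δu 0 k)
    (huhatS : ∀ t, 1 ≤ t → uhat (t + 1) =
      (if K ∣ (t - 1) then β • uhat t else uhat t) +
      η (nextF t (kseq (t - 1))) • Δu t (kseq (t - 1)))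
    (hwhat1 : what 1 = w0 - ∑ k, η (nextF 0 k) • Δw 0 k)
    (hwhatS : ∀ t, 1 ≤ t → what (t + 1) =
      (if K ∣ (t - 1) then what t - β • uhat t else what t) -
      η (nextF t (kseq (t - 1))) • Δw t (kseq (t - 1)))
    (hyhat1 : yhat 1 = w0 - (1 / (1 - β)) • ∑ k, η (nextF 0 k) • Δh 0 k)
    (hyhatS : ∀ t, 1 ≤ t → yhat (t + 1) =
      yhat t - (η (nextF t (kseq (t - 1))) / (1 - β)) • Δh t (kseq (t - 1)))
    (hh0 : ∀ k, (1 / (1 - β)) • Δh 0 k = (β / (1 - β)) • Δu 0 k + Δw 0 k)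
    (hhS : ∀ t, 1 ≤ t →
      (1 / (1 - β)) • Δh t (kseq (t - 1)) =
        (β / (1 - β)) • Δu t (kseq (t - 1)) + Δw t (kseq (t - 1))) :
    ∀ t, 1 ≤ t → yhat t - what t = -((β / (1 - β)) • uhat t) := by
  have hne : (1 - β) ≠ 0 := by linarith
  intro t ht
  induction t, ht using Nat.le_induction with
  | base =>
    have h : (1 / (1 - β)) • ∑ k, η (nextF 0 k) • Δh 0 k =
        (β / (1 - β)) • ∑ k, η (nextF 0 k) • Δu 0 k + ∑ k, η (nextF 0 k) • Δw 0 k := by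
      rw [Finset.smul_sum, Finset.smul_sum, ← Finset.sum_add_distrib]
      refine Finset.sum_congr rfl fun k _ => ?_
      rw [smul_comm, hh0 k, smul_add, smul_comm]
    rw [hyhat1, hwhat1, huhat1, h]
    abel
  | succ t ht ih =>
    have h := hhS t ht
    have hy : yhat t = what t - (β / (1 - β)) • uhat t := by
      rw [sub_eq_iff_eq_add] at ih
      rw [ih]; abel
    have h2 : (η (nextF t (kseq (t - 1))) / (1 - β)) • Δh t (kseq (t - 1)) =
        η (nextF t (kseq (t - 1))) •
          ((β / (1 - β)) • Δu t (kseq (t - 1)) + Δw t (kseq (t - 1))) := by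
      rw [← h, smul_smul, mul_one_div]
    rw [hyhatS t ht, hwhatS t ht, huhatS t ht, h2, hy]
    have hc : β = β / (1 - β) - β / (1 - β) * β := by field_simp
    split_ifs
    · have hu : β • uhat t = (β / (1 - β)) • uhat t - (β / (1 - β)) • β • uhat t := by
        rw [smul_smul, ← sub_smul, ← hc]
      rw [smul_add (β / (1 - β)), sub_eq_iff_eq_add.mp hu.symm]
      module
    · module
end

section
/- For every t ≥ 1, the auxiliary momentum admits the closed form û_t = β^{⌊(t+K−2)/K⌋} ( Σ_{k ∈ [K]} η̂_{0,k} Δu_0^k ) + Σ_{q=1}^{⌊(t+K−2)/K⌋} β^{⌊(t+K−2)/K⌋ − q} ( Σ_{j=(q−1)K+1}^{min{qK, t−1}} η̂_{j, k_{j−1}} Δu_j^{k_{j−1}} ). -/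
open scoped BigOperators

theorem aux_closed {E : Type*} [AddCommGroup E] [Module ℝ E] (K : ℕ) (hK : 1 ≤ K) (β : ℝ)
    (g w : ℕ → E) (v : E) (h0 : w 0 = v)
    (hS : ∀ s, w (s + 1) = (if K ∣ s then β • w s else w s) + g (s + 1)) (s : ℕ) :
    w s = β ^ ((s + K - 1) / K) • v + ∑ q ∈ Finset.Icc 1 ((s + K - 1) / K),
      β ^ ((s + K - 1) / K - q) •
        ∑ j ∈ Finset.Icc ((q - 1) * K + 1) (min (q * K) s), g j := by
  induction s with
  | zero =>
    have : (0 + K - 1) / K = 0 := Nat.div_eq_of_lt (by omega)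
    rw [this]
    simp [h0]
  | succ s ih =>
    rw [hS]
    by_cases hd : K ∣ s
    · obtain ⟨m, rfl⟩ := hd
      have e1 : (K * m + K - 1) / K = m := by
        rw [Nat.div_eq_iff (by omega)]
        rw [mul_comm m K]
        constructor <;> omega
      have e2 : (K * m + 1 + K - 1) / K = m + 1 := by
        rw [show K * m + 1 + K - 1 = K * (m + 1) by rw [Nat.mul_add]; omega]
        exact Nat.mul_div_cancel_left _ (by omega)
      rw [e1] at ih
      rw [e2, if_pos (dvd_mul_right _ _), ih, Finset.sum_Icc_succ_top (by omega), smul_add,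
        smul_smul, ← pow_succ', Finset.smul_sum, add_assoc]
      congr 2
      · refine Finset.sum_congr rfl fun q hq => ?_
        rw [Finset.mem_Icc] at hq
        have hle : q * K ≤ K * m := by rw [mul_comm K m]; exact Nat.mul_le_mul_right _ hq.2
        rw [smul_smul, ← pow_succ', show m - q + 1 = m + 1 - q by omega,
          min_eq_left hle, min_eq_left (by omega)]
      · have : min ((m + 1) * K) (K * m + 1) = K * m + 1 := by
          apply min_eq_right
          rw [Nat.add_mul, mul_comm m K]; omega
        rw [this]
        simp [mul_comm m K]
    · have hr : 0 < s % K := Nat.pos_of_ne_zero fun h => hd (Nat.dvd_of_mod_eq_zero h)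
      have hrK : s % K < K := Nat.mod_lt _ (by omega)
      have hs := Nat.div_add_mod s K
      generalize s / K = a at hs
      generalize s % K = r at hs hr hrK
      have hc : a * K = K * a := mul_comm _ _
      have e1 : (s + K - 1) / K = a + 1 := by
        rw [show s + K - 1 = (r - 1) + K * (a + 1) by rw [Nat.mul_add]; omega,
          Nat.add_mul_div_left _ _ (by omega), Nat.div_eq_of_lt (by omega)]; omega
      have e2 : (s + 1 + K - 1) / K = a + 1 := by
        rw [show s + 1 + K - 1 = r + K * (a + 1) by rw [Nat.mul_add]; omega,
          Nat.add_mul_div_left _ _ (by omega), Nat.div_eq_of_lt (by omega)]; omega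
      rw [e1] at ih
      rw [e2, if_neg hd, ih, Finset.sum_Icc_succ_top (by omega),
        Finset.sum_Icc_succ_top (by omega), add_assoc, add_assoc]
      congr 2
      · refine Finset.sum_congr rfl fun q hq => ?_
        rw [Finset.mem_Icc] at hq
        have hle : q * K ≤ a * K := Nat.mul_le_mul_right _ hq.2
        rw [min_eq_left (by omega), min_eq_left (by omega)]
      · have hx : (a + 1) * K = K * a + K := by rw [Nat.add_mul, hc]; omega
        rw [min_eq_right (by omega), min_eq_right (by omega), Nat.sub_self, pow_zero, one_smul,
          one_smul, Finset.sum_Icc_succ_top]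
        rw [Nat.add_sub_cancel]; omega

/-- closed form of the auxiliary momentum, for every `t ≥ 1`:
`û_t = β^{⌊(t+K−2)/K⌋} (Σ_{k∈[K]} η̂_{0,k} Δu_0^k)
  + Σ_{q=1}^{⌊(t+K−2)/K⌋} β^{⌊(t+K−2)/K⌋−q}
      (Σ_{j=(q−1)K+1}^{min{qK,t−1}} η̂_{j,k_{j−1}} Δu_j^{k_{j−1}})`. -/
theorem stmt_5 (d K : ℕ) (hK : 1 ≤ K) (β : ℝ) (hβ0 : 0 ≤ β) (hβ1 : β < 1)
    (kseq : ℕ → Fin K)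
    (nextF : ℕ → Fin K → ℕ)
    (hnext : ∀ t k, t ≤ nextF t k ∧ kseq (nextF t k) = k ∧
      ∀ j, t ≤ j → kseq j = k → nextF t k ≤ j)
    (η : ℕ → ℝ) (hη : ∀ t, 0 < η t)
    (Δu : ℕ → Fin K → EuclideanSpace ℝ (Fin d))
    (uhat : ℕ → EuclideanSpace ℝ (Fin d))
    (huhat1 : uhat 1 = ∑ k, η (nextF 0 k) • Δu 0 k)
    (huhatS : ∀ t, 1 ≤ t → uhat (t + 1) =
      (if K ∣ (t - 1) then β • uhat t else uhat t) +
      η (nextF t (kseq (t - 1))) • Δu t (kseq (t - 1))) :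
    ∀ t, 1 ≤ t →
      uhat t =
        β ^ ((t + K - 2) / K) • (∑ k, η (nextF 0 k) • Δu 0 k) +
        ∑ q ∈ Finset.Icc 1 ((t + K - 2) / K),
          β ^ ((t + K - 2) / K - q) •
            ∑ j ∈ Finset.Icc ((q - 1) * K + 1) (min (q * K) (t - 1)),
              η (nextF j (kseq (j - 1))) • Δu j (kseq (j - 1)) := by
  intro t ht
  obtain ⟨s, rfl⟩ : ∃ s, t = s + 1 := ⟨t - 1, by omega⟩
  have h := aux_closed K hK β (fun j => η (nextF j (kseq (j - 1))) • Δu j (kseq (j - 1)))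
    (fun s => uhat (s + 1)) _ huhat1 (fun s => huhatS (s + 1) (by omega)) s
  rw [show s + 1 + K - 2 = s + K - 1 by omega]
  exact h
end

section
/- Define the per-worker staleness τ̂_{t,k} = t − ite(t,k) and the delay τ_t = t − ite(t, k_t). Then for every t ≥ 0 and k ∈ [K], τ̂_{t+1,k} = τ̂_{t,k} + 1 if k ≠ k_t and τ̂_{t+1,k} = τ̂_{t,k} − τ_t = 0 if k = k_t; consequently, for every T ≥ 1, Σ_{k ∈ [K]} τ̂_{T,k} + Σ_{t=0}^{T−1} τ_t = (K−1)·T, and in particular Σ_{t=0}^{T−1} τ_t ≤ (K−1)·T. -/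
open scoped BigOperators

/-- with `τ̂_{t,k} = t − ite(t,k)` and `τ_t = t − ite(t,k_t)`:
for every `t` and `k`, `τ̂_{t+1,k} = τ̂_{t,k} + 1` if `k ≠ k_t`, and
`τ̂_{t+1,k} = τ̂_{t,k} − τ_t = 0` if `k = k_t`; consequently for every `T ≥ 1`,
`Σ_{k∈[K]} τ̂_{T,k} + Σ_{t<T} τ_t = (K−1)·T`, so `Σ_{t<T} τ_t ≤ (K−1)·T`. -/
theorem stmt_7 (K : ℕ) (hK : 1 ≤ K)
    (kseq : ℕ → Fin K)
    (iteF : ℕ → Fin K → ℕ)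
    (hite0 : ∀ k, iteF 0 k = 0)
    (hiteS : ∀ t k, iteF (t + 1) k = if k = kseq t then t + 1 else iteF t k) :
    (∀ t (k : Fin K),
      (k ≠ kseq t → (t + 1) - iteF (t + 1) k = (t - iteF t k) + 1) ∧
      (k = kseq t →
        (t + 1) - iteF (t + 1) k = (t - iteF t k) - (t - iteF t (kseq t)) ∧
        (t + 1) - iteF (t + 1) k = 0)) ∧
    ∀ T, 1 ≤ T →
      (∑ k : Fin K, (T - iteF T k)) +
        (∑ t ∈ Finset.range T, (t - iteF t (kseq t))) = (K - 1) * T ∧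
      ∑ t ∈ Finset.range T, (t - iteF t (kseq t)) ≤ (K - 1) * T := by
  have hle : ∀ t k, iteF t k ≤ t := by
    intro t
    induction t with
    | zero => intro k; simp [hite0]
    | succ t ih =>
      intro k
      rw [hiteS]
      have := ih k
      split_ifs <;> omega
  have hsum : ∀ T, (∑ k : Fin K, (T - iteF T k)) +
        (∑ t ∈ Finset.range T, (t - iteF t (kseq t))) = (K - 1) * T := by
    intro T
    induction T with
    | zero => simp
    | succ T ih =>
      have hp : ∀ k : Fin K, (T + 1 - iteF (T + 1) k) +
          (if k = kseq T then (T - iteF T k) + 1 else 0) = (T - iteF T k) + 1 := by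
        intro k
        rw [hiteS]
        have := hle T k
        split_ifs <;> omega
      have hs := Finset.sum_congr (rfl : (Finset.univ : Finset (Fin K)) = Finset.univ)
        (fun k _ => hp k)
      rw [Finset.sum_add_distrib, Finset.sum_add_distrib] at hs
      simp only [Finset.sum_ite_eq', Finset.sum_ite_eq, Finset.mem_univ, if_true,
        Finset.sum_const, Finset.card_univ, Fintype.card_fin, smul_eq_mul, mul_one] at hs
      rw [Finset.sum_range_succ, Nat.mul_succ]
      omega
  refine ⟨fun t k => ⟨fun h => ?_, fun h => ?_⟩, fun T _ => ⟨hsum T, ?_⟩⟩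
  · have := hle t k
    rw [hiteS, if_neg h]
    omega
  · rw [hiteS, if_pos h, h]
    omega
  · have := hsum T
    omega
end

section
/- Define the delay τ_t = t − ite(t, k_t) and the global learning rates η_t = 1/K if τ_t ≤ 2K and η_t = 1/τ_t if τ_t > 2K. Then for every T ≥ 1 at least T/2 of the indices t ∈ {0,…,T−1} satisfy τ_t < 2K, and consequently Σ_{t=0}^{T−1} η_t ≥ T/(2K). -/
open scoped BigOperators

/-- with `τ_t = t − ite(t,k_t)` and `η_t = 1/K` if `τ_t ≤ 2K`,
`η_t = 1/τ_t` if `τ_t > 2K`, for every `T ≥ 1` at least `T/2` of the indices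
`t < T` satisfy `τ_t < 2K`, and hence `Σ_{t<T} η_t ≥ T/(2K)`. -/
theorem stmt_8 (K : ℕ) (hK : 1 ≤ K)
    (kseq : ℕ → Fin K)
    (iteF : ℕ → Fin K → ℕ)
    (hite0 : ∀ k, iteF 0 k = 0)
    (hiteS : ∀ t k, iteF (t + 1) k = if k = kseq t then t + 1 else iteF t k)
    (η : ℕ → ℝ)
    (hη : ∀ t, η t =
      if t - iteF t (kseq t) ≤ 2 * K then 1 / (K : ℝ)
      else 1 / ((t - iteF t (kseq t) : ℕ) : ℝ)) :
    ∀ T : ℕ, 1 ≤ T →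
      (T : ℝ) / 2 ≤
        (((Finset.range T).filter (fun t => t - iteF t (kseq t) < 2 * K)).card : ℝ) ∧
      (T : ℝ) / (2 * K) ≤ ∑ t ∈ Finset.range T, η t := by
  have hle : ∀ t k, iteF t k ≤ t := by
    intro t
    induction t with
    | zero => intro k; simp [hite0]
    | succ n ih =>
      intro k
      rw [hiteS]
      split_ifs
      · exact le_rfl
      · exact (ih k).trans (Nat.le_succ n)
  have hsum : ∀ T, ∑ t ∈ Finset.range T, (t - iteF t (kseq t) + 1) = ∑ k, iteF T k := by
    intro T
    induction T with
    | zero => simp [hite0]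
    | succ n ih =>
      rw [Finset.sum_range_succ, ih,
        ← Finset.add_sum_erase _ _ (Finset.mem_univ (kseq n)),
        ← Finset.add_sum_erase _ (iteF (n + 1)) (Finset.mem_univ (kseq n))]
      have h1 : ∑ k ∈ Finset.univ.erase (kseq n), iteF (n + 1) k
          = ∑ k ∈ Finset.univ.erase (kseq n), iteF n k := by
        apply Finset.sum_congr rfl
        intro k hk
        rw [hiteS, if_neg (Finset.ne_of_mem_erase hk)]
      have h2 : iteF (n + 1) (kseq n) = n + 1 := by rw [hiteS, if_pos rfl]
      rw [h1, h2]
      have := hle n (kseq n)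
      omega
  intro T _
  have hbound : ∑ t ∈ Finset.range T, (t - iteF t (kseq t) + 1) ≤ K * T := by
    rw [hsum]
    calc ∑ k, iteF T k ≤ ∑ _k : Fin K, T := Finset.sum_le_sum (fun k _ => hle T k)
      _ = K * T := by simp
  have hcard := Finset.card_filter_add_card_filter_not (s := Finset.range T)
    (fun t => t - iteF t (kseq t) < 2 * K)
  rw [Finset.card_range] at hcard
  have hbad : ((Finset.range T).filter (fun t => ¬ t - iteF t (kseq t) < 2 * K)).card * (2 * K)
      ≤ K * T := by
    refine le_trans ?_ hbound
    refine le_trans ?_ (Finset.sum_le_sum_of_subset (Finset.filter_subset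
      (fun t => ¬ t - iteF t (kseq t) < 2 * K) (Finset.range T)))
    rw [← smul_eq_mul]
    apply Finset.card_nsmul_le_sum
    intro t ht
    have := (Finset.mem_filter.mp ht).2
    omega
  have hbad2 : ((Finset.range T).filter (fun t => ¬ t - iteF t (kseq t) < 2 * K)).card * 2 ≤ T := by
    apply Nat.le_of_mul_le_mul_left _ (show 0 < K by omega)
    linarith
  have hgood : T ≤ 2 * ((Finset.range T).filter (fun t => t - iteF t (kseq t) < 2 * K)).card := by
    omega
  have hgoodR : (T : ℝ) / 2 ≤
      (((Finset.range T).filter (fun t => t - iteF t (kseq t) < 2 * K)).card : ℝ) := by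
    have : (T : ℝ) ≤ 2 * (((Finset.range T).filter
        (fun t => t - iteF t (kseq t) < 2 * K)).card : ℝ) := by exact_mod_cast hgood
    linarith
  refine ⟨hgoodR, ?_⟩
  have hKR : (0 : ℝ) < K := by exact_mod_cast hK
  calc (T : ℝ) / (2 * K) = (T : ℝ) / 2 * (1 / K) := by field_simp
    _ ≤ (((Finset.range T).filter (fun t => t - iteF t (kseq t) < 2 * K)).card : ℝ) * (1 / K) := by
        gcongr
    _ = ∑ t ∈ (Finset.range T).filter (fun t => t - iteF t (kseq t) < 2 * K), η t := by
        rw [← nsmul_eq_mul, ← Finset.sum_const]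
        apply Finset.sum_congr rfl
        intro t ht
        rw [hη, if_pos (Finset.mem_filter.mp ht).2.le]
    _ ≤ ∑ t ∈ Finset.range T, η t := by
        apply Finset.sum_le_sum_of_subset_of_nonneg (Finset.filter_subset _ _)
        intro t _ _
        rw [hη]
        split_ifs <;> positivity
end
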